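/- arXiv:1209.0002 — 2 statements merged into one kernel-verified Lean document; each statement's English description precedes it below -/
import Mathlib

section
/- Let A, W ∈ SL(2,ℂ), set x := tr A, and β := tr(A·W·A·W⁻¹). Then tr(A⁻¹·W⁻¹·A·W·A·W⁻¹·A·W) = β·(x² − β) − (x² − 2). -/
/-- The trace of an element of `SL(2,ℂ)`, i.e. the trace of the underlying matrix. -/
noncomputable def tr (A : Matrix.SpecialLinearGroup (Fin 2) ℂ) : ℂ :=
  Matrix.trace (A : Matrix (Fin 2) (Fin 2) ℂ)

theorem tr_mul_comm (A B : Matrix.SpecialLinearGroup (Fin 2) ℂ) : tr (A * B) = tr (B * A) := by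
  simp only [tr, Matrix.SpecialLinearGroup.coe_mul]
  exact Matrix.trace_mul_comm _ _

theorem tr_conj (A W : Matrix.SpecialLinearGroup (Fin 2) ℂ) : tr (W⁻¹ * A * W) = tr A := by
  rw [tr_mul_comm, mul_inv_cancel_left]

theorem tr_one : tr 1 = 2 := by
  simp [tr]

/-- The fundamental trace identity in `SL(2,ℂ)`. -/
theorem tr_mul_add_tr_mul_inv (A B : Matrix.SpecialLinearGroup (Fin 2) ℂ) :
    tr (A * B) + tr (A * B⁻¹) = tr A * tr B := by
  simp only [tr, Matrix.SpecialLinearGroup.coe_mul, Matrix.SpecialLinearGroup.coe_inv,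
    Matrix.trace_fin_two, Matrix.mul_apply, Fin.sum_univ_two, Matrix.adjugate_fin_two,
    Matrix.of_apply, Matrix.cons_val', Matrix.cons_val_zero, Matrix.cons_val_one,
    Matrix.cons_val_fin_one]
  ring

theorem tr_inv (A : Matrix.SpecialLinearGroup (Fin 2) ℂ) : tr A⁻¹ = tr A := by
  have h := tr_mul_add_tr_mul_inv 1 A
  rw [one_mul, one_mul, tr_one] at h
  linear_combination h

/-- The trace of the word `A⁻¹BAB` when `A` and `B` have the same trace. -/
theorem tr_inv_mul_mul_mul (A B : Matrix.SpecialLinearGroup (Fin 2) ℂ) (h : tr B = tr A) :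
    tr (A⁻¹ * B * (A * B)) = tr (A * B) * (tr A ^ 2 - tr (A * B)) - (tr A ^ 2 - 2) := by
  have h₁ := tr_mul_add_tr_mul_inv (A⁻¹ * B) (A * B)
  have h₂ := tr_mul_add_tr_mul_inv B A
  have h₃ := tr_mul_add_tr_mul_inv A⁻¹ A
  rw [mul_inv_rev, mul_assoc A⁻¹ B (B⁻¹ * A⁻¹), mul_inv_cancel_left] at h₁
  rw [tr_mul_comm B A, tr_mul_comm B A⁻¹, h] at h₂
  rw [inv_mul_cancel, tr_one, tr_inv] at h₃
  linear_combination h₁ - h₃ + tr (A * B) * h₂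

/-- With `x = tr A` and `β = tr (A*W*A*W⁻¹)`, one has
`tr (A⁻¹*W⁻¹*A*W*A*W⁻¹*A*W) = β*(x² - β) - (x² - 2)`. -/
theorem trace_word11 (A W : Matrix.SpecialLinearGroup (Fin 2) ℂ) :
    tr (A⁻¹ * W⁻¹ * A * W * A * W⁻¹ * A * W)
      = tr (A * W * A * W⁻¹) * (tr A ^ 2 - tr (A * W * A * W⁻¹)) - (tr A ^ 2 - 2) := by
  have hβ : tr (A * W * A * W⁻¹) = tr (A * (W⁻¹ * A * W)) := by
    rw [tr_mul_comm, tr_mul_comm A]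
    simp only [mul_assoc]
  rw [hβ, ← tr_inv_mul_mul_mul A (W⁻¹ * A * W) (tr_conj A W)]
  simp only [mul_assoc]
end

section
/- Fix integers m, n. In the ring R[y] with R := ℂ[x,z], set β := x·y·z + 2 − y² − z², α := y·S_{m−1}(β) − (x·z − y)·S_{m−2}(β), and Q := (x·z − y)·S_{n−1}(α) − (S_m(β) − S_{m−1}(β))·S_{n−2}(α). Then the y-degree and leading coefficient (in y) of Q are: degree 2mn−2m−n with leading coefficient (−1)^((m−1)(n−1))·z² if m ≥ 2 and n ≥ 2; degree −2mn+2m+n with leading coefficient −(−1)^((m−1)(n−1)) if m ≥ 2 and n ≤ 1; degree n−2 with leading coefficient z² if m = 1 and n ≥ 3; Q = z² − 1 if m = 1 and n = 2; degree 2−n with leading coefficient −1 if m = 1 and n ≤ 1; degree n with leading coefficient (−1)^n if m = 0 and n ≥ 0; Q = 0 if m = 0 and n = −1; degree −(n+2) with leading coefficient (−1)^(n−1) if m = 0 and n ≤ −2; degree −2mn+2m+n with leading coefficient −(−1)^((m−1)(n−1)) if m ≤ −1 and n ≥ 1; degree 2mn−2m−n−2 with leading coefficient (−1)^((m−1)(n−1))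 if m ≤ −1 and n ≤ 0. -/
open Polynomial

/-- The normalized Chebyshev polynomials `S k` (`k : ℤ`), determined by
`S 0 = 1`, `S 1 = X`, and the recurrence `S (k + 1) = X * S k - S (k - 1)` for all `k : ℤ`. -/
@[semireducible] noncomputable def chebS (R : Type*) [CommRing R] : ℤ → R[X]
  | 0 => 1
  | 1 => X
  | (n : ℕ) + 2 => X * chebS R (n + 1) - chebS R n
  | -((n : ℕ) + 1) => X * chebS R (-n) - chebS R (-n + 1)
  termination_by n => Int.natAbs n + Int.natAbs (n - 1)

/-- The variable `x`, viewed as a constant polynomial in `y` over `R = ℂ[x,z]`. -/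
noncomputable def xP : Polynomial (MvPolynomial (Fin 2) ℂ) := Polynomial.C (MvPolynomial.X 0)

/-- The variable `z`, viewed as a constant polynomial in `y` over `R = ℂ[x,z]`. -/
noncomputable def zP : Polynomial (MvPolynomial (Fin 2) ℂ) := Polynomial.C (MvPolynomial.X 1)

/-- `β = x*y*z + 2 - y² - z²` as a polynomial in `y` over `R = ℂ[x,z]`. -/
noncomputable def betaP : Polynomial (MvPolynomial (Fin 2) ℂ) :=
  xP * Polynomial.X * zP + 2 - Polynomial.X ^ 2 - zP ^ 2

/-- `α = y * S (m-1) (β) - (x*z - y) * S (m-2) (β)` as a polynomial in `y` over `ℂ[x,z]`. -/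
noncomputable def alphaP (m : ℤ) : Polynomial (MvPolynomial (Fin 2) ℂ) :=
  Polynomial.X * (chebS (Polynomial (MvPolynomial (Fin 2) ℂ)) (m - 1)).eval betaP
    - (xP * zP - Polynomial.X) * (chebS (Polynomial (MvPolynomial (Fin 2) ℂ)) (m - 2)).eval betaP

/-- `Q = (x*z - y) * S (n-1) (α) - (S m (β) - S (m-1) (β)) * S (n-2) (α)`
as a polynomial in `y` over `ℂ[x,z]`. -/
noncomputable def QP (m n : ℤ) : Polynomial (MvPolynomial (Fin 2) ℂ) :=
  (xP * zP - Polynomial.X) * (chebS (Polynomial (MvPolynomial (Fin 2) ℂ)) (n - 1)).eval (alphaP m)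
    - ((chebS (Polynomial (MvPolynomial (Fin 2) ℂ)) m).eval betaP
          - (chebS (Polynomial (MvPolynomial (Fin 2) ℂ)) (m - 1)).eval betaP)
        * (chebS (Polynomial (MvPolynomial (Fin 2) ℂ)) (n - 2)).eval (alphaP m)

section TopCoeff

variable {R : Type*} [CommRing R]

/-- `p` has degree at most `d`, and its coefficient in degree `d` (possibly zero) is `c`. -/
structure HasTopCoeff (p : R[X]) (d : ℕ) (c : R) : Prop where
  natDegree_le : p.natDegree ≤ d
  coeff_eq : p.coeff d = c

namespace HasTopCoeff

variable {p q : R[X]} {d e : ℕ} {a b : R}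

theorem mul (hp : HasTopCoeff p d a) (hq : HasTopCoeff q e b) :
    HasTopCoeff (p * q) (d + e) (a * b) :=
  ⟨natDegree_mul_le_of_le hp.1 hq.1, by
    rw [coeff_mul_add_eq_of_natDegree_le hp.1 hq.1, hp.2, hq.2]⟩

theorem sub (hp : HasTopCoeff p d a) (hq : HasTopCoeff q d b) :
    HasTopCoeff (p - q) d (a - b) :=
  ⟨(natDegree_sub_le_of_le hp.1 hq.1).trans (max_self d).le, by rw [coeff_sub, hp.2, hq.2]⟩

theorem of_natDegree_lt (h : p.natDegree < d) : HasTopCoeff p d 0 :=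
  ⟨h.le, coeff_eq_zero_of_natDegree_lt h⟩

theorem of_lt (hp : HasTopCoeff p d a) (h : d < e) : HasTopCoeff p e 0 :=
  of_natDegree_lt (hp.1.trans_lt h)

theorem congr (hp : HasTopCoeff p d a) (hd : d = e) (hab : a = b) : HasTopCoeff p e b := by
  subst hd hab; exact hp

theorem const (a : R) : HasTopCoeff (C a) 0 a := ⟨by simp, by simp⟩

theorem zero (d : ℕ) : HasTopCoeff (0 : R[X]) d 0 := ⟨by simp, by simp⟩

theorem X : HasTopCoeff (X : R[X]) 1 1 := ⟨natDegree_X_le, by simp⟩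

theorem natDegree_eq_and_leadingCoeff_eq (hp : HasTopCoeff p d a) (ha : a ≠ 0) {z : ℤ}
    (hz : z = d) (hab : a = b) : p.natDegree = z.toNat ∧ p.leadingCoeff = b := by
  have h : p.natDegree = d := natDegree_eq_of_le_of_coeff_ne_zero hp.1 (by rwa [hp.2])
  exact ⟨by simp [hz, h], by rw [leadingCoeff, h, hp.2, hab]⟩

/-- Degrees in a sequence obeying a Chebyshev recurrence, in the direction of increasing index. -/
theorem of_recurrence {f : ℤ → R[X]} {α : R[X]} (hf : ∀ n, f (n + 1) = α * f n - f (n - 1))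
    (hα : HasTopCoeff α d a) (hd : 0 < d) (s : ℤ) (h : HasTopCoeff (f s) e b)
    (h' : (f (s - 1)).natDegree < e + d) (k : ℕ) :
    HasTopCoeff (f (s + k)) (e + k * d) (b * a ^ k) := by
  suffices H : HasTopCoeff (f (s + k)) (e + k * d) (b * a ^ k) ∧
      (f (s + k - 1)).natDegree < e + k * d + d from H.1
  induction k with
  | zero => simpa using ⟨h, h'⟩
  | succ k ih =>
    obtain ⟨ih₁, ih₂⟩ := ih
    have hs : s + ((k + 1 : ℕ) : ℤ) = s + k + 1 := by push_cast; ring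
    rw [hs, add_sub_cancel_right]
    have hk : e + (k + 1) * d = e + k * d + d := by ring
    refine ⟨?_, by have := ih₁.1; omega⟩
    rw [hf, hk]
    exact ((hα.mul ih₁).congr (add_comm _ _) rfl |>.sub (of_natDegree_lt ih₂)).congr rfl
      (by ring)

/-- Degrees in a sequence obeying a Chebyshev recurrence, in the direction of decreasing index. -/
theorem of_recurrence_neg {f : ℤ → R[X]} {α : R[X]} (hf : ∀ n, f (n + 1) = α * f n - f (n - 1))
    (hα : HasTopCoeff α d a) (hd : 0 < d) (s : ℤ) (h : HasTopCoeff (f s) e b)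
    (h' : (f (s + 1)).natDegree < e + d) (k : ℕ) :
    HasTopCoeff (f (s - k)) (e + k * d) (b * a ^ k) := by
  have hg : ∀ n, f (-(n + 1)) = α * f (-n) - f (-(n - 1)) := fun n ↦ by
    have := hf (-n)
    rw [show -(n + 1) = -n - 1 by ring, show -(n - 1) = -n + 1 by ring, this]
    ring
  have := of_recurrence (f := fun n ↦ f (-n)) hg hα hd (-s) (by simpa using h)
    (by simpa [add_comm] using h') k
  simpa [neg_add_eq_sub] using this

end HasTopCoeff

end TopCoeff

section Chebyshev

variable (R : Type*) [CommRing R]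

theorem chebS_add_two : ∀ n, chebS R (n + 2) = X * chebS R (n + 1) - chebS R n
  | (k : ℕ) => chebS.eq_3 R k
  | -(k + 1 : ℕ) => by
    have h : chebS R (-(k + 1 : ℕ)) = X * chebS R (-k) - chebS R (-k + 1) := by
      exact chebS.eq_4 R k
    rw [h, show -((k + 1 : ℕ) : ℤ) + 2 = -k + 1 by push_cast; ring,
      show -((k + 1 : ℕ) : ℤ) + 1 = -k by push_cast; ring]
    ring

variable {R}

theorem eval_chebS_add_one (p : R) (n : ℤ) :
    (chebS R (n + 1)).eval p = p * (chebS R n).eval p - (chebS R (n - 1)).eval p := by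
  have := chebS_add_two R (n - 1)
  rw [show n - 1 + 2 = n + 1 by ring, sub_add_cancel] at this
  simp [this]

theorem eval_chebS_zero (p : R) : (chebS R 0).eval p = 1 := by simp [chebS]

theorem eval_chebS_one (p : R) : (chebS R 1).eval p = p := by simp [chebS]

theorem eval_chebS_neg_one (p : R) : (chebS R (-1)).eval p = 0 := by
  have := eval_chebS_add_one p 0
  simp only [zero_add, eval_chebS_one, eval_chebS_zero, zero_sub] at this
  linear_combination this

theorem eval_chebS_neg_two (p : R) : (chebS R (-2)).eval p = -1 := by
  have := eval_chebS_add_one p (-1)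
  norm_num [eval_chebS_neg_one, eval_chebS_zero] at this
  linear_combination this

end Chebyshev

local notation "A" => MvPolynomial (Fin 2) ℂ

theorem QP_add_one (m n : ℤ) : QP m (n + 1) = alphaP m * QP m n - QP m (n - 1) := by
  have h₁ := eval_chebS_add_one (alphaP m) (n - 1)
  have h₂ := eval_chebS_add_one (alphaP m) (n - 2)
  rw [show n - 1 + 1 = n + 1 - 1 by ring] at h₁
  rw [show n - 2 + 1 = n + 1 - 2 by ring, show n - 2 - 1 = n - 1 - 2 by ring] at h₂
  simp only [QP, h₁, h₂]
  ring

theorem QP_one (m : ℤ) : QP m 1 = xP * zP - X := by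
  norm_num [QP, eval_chebS_zero, eval_chebS_neg_one]

theorem QP_zero (m : ℤ) :
    QP m 0 = (chebS A[X] m).eval betaP - (chebS A[X] (m - 1)).eval betaP := by
  simp only [QP, zero_sub, eval_chebS_neg_one, eval_chebS_neg_two]
  ring

theorem QP_two (m : ℤ) : QP m 2 = (zP ^ 2 - 1) * (chebS A[X] (m - 1)).eval betaP
    - ((xP * zP - X) ^ 2 - 1) * (chebS A[X] (m - 2)).eval betaP := by
  have h := QP_add_one m 1
  have hb := eval_chebS_add_one betaP (m - 1)
  rw [sub_add_cancel, show m - 1 - 1 = m - 2 by ring] at hb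
  norm_num only at h
  rw [h, QP_one, QP_zero, hb, alphaP]
  simp only [betaP]
  ring

theorem hasTopCoeff_sub_X : HasTopCoeff (xP * zP - X) 1 (-1) := by
  have h : HasTopCoeff (xP * zP) 1 0 :=
    ((HasTopCoeff.const _).mul (HasTopCoeff.const _)).of_lt (by norm_num)
  exact (h.sub HasTopCoeff.X).congr rfl (by ring)

theorem hasTopCoeff_betaP : HasTopCoeff betaP 2 (-1) := by
  have h : HasTopCoeff (X * (xP * zP - X)) 2 (-1) :=
    (HasTopCoeff.X.mul hasTopCoeff_sub_X).congr rfl (by ring)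
  have h' : HasTopCoeff (C ((MvPolynomial.X 1 : A) ^ 2 - 2)) 2 0 :=
    (HasTopCoeff.const _).of_lt (by norm_num)
  have hb : betaP = X * (xP * zP - X) - C ((MvPolynomial.X 1 : A) ^ 2 - 2) := by
    simp only [betaP, zP, map_sub, map_pow, map_ofNat]
    ring
  rw [hb]
  exact (h.sub h').congr rfl (by ring)

theorem hasTopCoeff_eval_chebS (k : ℕ) :
    HasTopCoeff ((chebS A[X] k).eval betaP) (2 * k) ((-1) ^ k) := by
  have := HasTopCoeff.of_recurrence (f := fun n ↦ (chebS A[X] n).eval betaP)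
    (eval_chebS_add_one betaP) hasTopCoeff_betaP (by norm_num) 0
    (e := 0) (b := 1) (by rw [eval_chebS_zero]; exact HasTopCoeff.const 1)
    (by norm_num [eval_chebS_neg_one]) k
  rw [zero_add] at this
  exact this.congr (by ring) (by ring)

theorem hasTopCoeff_eval_chebS_neg (k : ℕ) :
    HasTopCoeff ((chebS A[X] (-2 - k)).eval betaP) (2 * k) (-(-1) ^ k) := by
  have := HasTopCoeff.of_recurrence_neg (f := fun n ↦ (chebS A[X] n).eval betaP)
    (eval_chebS_add_one betaP) hasTopCoeff_betaP (by norm_num) (-2) (e := 0) (b := -1)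
    (by rw [eval_chebS_neg_two]; simpa using HasTopCoeff.const (-1 : A))
    (by norm_num [eval_chebS_neg_one]) k
  exact this.congr (by ring) (by ring)

theorem hasTopCoeff_alphaP_add_two (k : ℕ) :
    HasTopCoeff (alphaP (k + 2)) (2 * k + 3) ((-1) ^ (k + 1)) := by
  have h₁ := hasTopCoeff_eval_chebS (k + 1)
  have h₂ := hasTopCoeff_eval_chebS k
  rw [alphaP, show (k : ℤ) + 2 - 1 = (k + 1 : ℕ) by push_cast; ring, add_sub_cancel_right]
  exact (((HasTopCoeff.X.mul h₁).congr (by ring) rfl).sub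
    ((hasTopCoeff_sub_X.mul h₂).of_lt (by omega))).congr rfl (by ring)

theorem hasTopCoeff_alphaP_neg (k : ℕ) :
    HasTopCoeff (alphaP (-1 - k)) (2 * k + 3) ((-1) ^ k) := by
  have h₁ := hasTopCoeff_eval_chebS_neg (k + 1)
  have h₂ := hasTopCoeff_eval_chebS_neg k
  rw [alphaP, show (-1 : ℤ) - k - 2 = -2 - (k + 1 : ℕ) by push_cast; ring,
    show (-1 : ℤ) - k - 1 = -2 - k by ring]
  exact (((HasTopCoeff.X.mul h₂).of_lt (by omega)).sub
    ((hasTopCoeff_sub_X.mul h₁).congr (by ring) rfl)).congr rfl (by ring)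

theorem alphaP_one : alphaP 1 = X := by
  norm_num [alphaP, eval_chebS_zero, eval_chebS_neg_one]

theorem alphaP_zero : alphaP 0 = xP * zP - X := by
  simp only [alphaP, zero_sub, eval_chebS_neg_one, eval_chebS_neg_two]
  ring

theorem hasTopCoeff_QP_zero (k : ℕ) :
    HasTopCoeff (QP (k + 1) 0) (2 * k + 2) ((-1) ^ (k + 1)) := by
  have h₁ := hasTopCoeff_eval_chebS (k + 1)
  have h₂ := hasTopCoeff_eval_chebS k
  rw [QP_zero, add_sub_cancel_right]
  rw [Nat.cast_succ] at h₁
  exact ((h₁.congr (by ring) rfl).sub (h₂.of_lt (by omega))).congr rfl (by ring)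

theorem hasTopCoeff_QP_zero_neg (k : ℕ) :
    HasTopCoeff (QP (-1 - k) 0) (2 * k) ((-1) ^ k) := by
  have h₁ : HasTopCoeff ((chebS A[X] (-1 - k)).eval betaP) (2 * k) 0 := by
    cases k with
    | zero => simpa [eval_chebS_neg_one] using HasTopCoeff.zero 0
    | succ k =>
      rw [show (-1 : ℤ) - (k + 1 : ℕ) = -2 - k by push_cast; ring]
      exact (hasTopCoeff_eval_chebS_neg k).of_lt (by omega)
  rw [QP_zero, show (-1 : ℤ) - k - 1 = -2 - k by ring]
  exact (h₁.sub (hasTopCoeff_eval_chebS_neg k)).congr rfl (by ring)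

theorem hasTopCoeff_QP_two (k : ℕ) :
    HasTopCoeff (QP (k + 2) 2) (2 * k + 2) ((-1) ^ (k + 1) * MvPolynomial.X 1 ^ 2) := by
  have h₁ := hasTopCoeff_eval_chebS (k + 1)
  have h₂ := hasTopCoeff_eval_chebS k
  have hz : HasTopCoeff (zP ^ 2 - 1) 0 (MvPolynomial.X 1 ^ 2 - 1) := by
    rw [show zP ^ 2 - 1 = C ((MvPolynomial.X 1 : A) ^ 2 - 1) by simp [zP]]
    exact HasTopCoeff.const _
  have hw : HasTopCoeff ((xP * zP - X) ^ 2 - 1) 2 1 := by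
    rw [sq]
    exact ((hasTopCoeff_sub_X.mul hasTopCoeff_sub_X).sub
      ((HasTopCoeff.const (1 : A)).of_lt (by norm_num))).congr rfl (by ring)
  rw [QP_two, show (k : ℤ) + 2 - 1 = (k + 1 : ℕ) by push_cast; ring, add_sub_cancel_right]
  exact (((hz.mul h₁).congr (by ring) rfl).sub
    ((hw.mul h₂).congr (add_comm _ _) rfl)).congr rfl (by ring)

theorem hasTopCoeff_QP_add_two_add_two (k j : ℕ) :
    HasTopCoeff (QP (k + 2) (2 + j)) (2 * k + 2 + j * (2 * k + 3))
      ((-1) ^ (k + 1) * MvPolynomial.X 1 ^ 2 * ((-1) ^ (k + 1)) ^ j) := by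
  refine HasTopCoeff.of_recurrence (QP_add_one _) (hasTopCoeff_alphaP_add_two k) (by omega) 2
    (hasTopCoeff_QP_two k) ?_ j
  norm_num only
  rw [QP_one]
  have := hasTopCoeff_sub_X.1
  omega

theorem hasTopCoeff_QP_add_two_neg (k j : ℕ) :
    HasTopCoeff (QP (k + 2) (0 - j)) (2 * k + 4 + j * (2 * k + 3))
      ((-1) ^ (k + 2) * ((-1) ^ (k + 1)) ^ j) := by
  have h := hasTopCoeff_QP_zero (k + 1)
  rw [show ((k + 1 : ℕ) : ℤ) + 1 = k + 2 by push_cast; ring] at h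
  refine HasTopCoeff.of_recurrence_neg (QP_add_one _) (hasTopCoeff_alphaP_add_two k) (by omega) 0
    (h.congr (by ring) rfl) ?_ j
  rw [zero_add, QP_one]
  have := hasTopCoeff_sub_X.1
  omega

theorem QP_one_two : QP 1 2 = C (MvPolynomial.X 1 ^ 2 - 1) := by
  rw [QP_two]
  norm_num [eval_chebS_zero, eval_chebS_neg_one, zP]

theorem hasTopCoeff_QP_one_add_three (j : ℕ) :
    HasTopCoeff (QP 1 (3 + j)) (1 + j * 1) (MvPolynomial.X 1 ^ 2 * 1 ^ j) := by
  have hα : HasTopCoeff (alphaP 1) 1 1 := alphaP_one ▸ HasTopCoeff.X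
  refine HasTopCoeff.of_recurrence (QP_add_one _) hα (by omega) 3 ?_ ?_ j
  · have h := QP_add_one 1 2
    norm_num only at h
    rw [h, QP_one, alphaP_one, QP_one_two]
    exact ((HasTopCoeff.X.mul (HasTopCoeff.const _)).sub hasTopCoeff_sub_X).congr rfl (by ring)
  · norm_num only
    rw [QP_one_two, natDegree_C]
    norm_num

theorem hasTopCoeff_QP_one_neg (j : ℕ) :
    HasTopCoeff (QP 1 (0 - j)) (2 + j * 1) (-1 * 1 ^ j) := by
  have hα : HasTopCoeff (alphaP 1) 1 1 := alphaP_one ▸ HasTopCoeff.X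
  refine HasTopCoeff.of_recurrence_neg (QP_add_one _) hα (by omega) 0
    (by simpa using hasTopCoeff_QP_zero 0) ?_ j
  rw [zero_add, QP_one]
  have := hasTopCoeff_sub_X.1
  omega

theorem QP_zero_zero : QP 0 0 = 1 := by
  rw [QP_zero]
  norm_num [eval_chebS_zero, eval_chebS_neg_one]

theorem QP_zero_neg_one : QP 0 (-1) = 0 := by
  have h := QP_add_one 0 0
  rw [zero_add, zero_sub, QP_one, QP_zero_zero, alphaP_zero] at h
  linear_combination h

theorem QP_zero_neg_two : QP 0 (-2) = -1 := by
  have h := QP_add_one 0 (-1)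
  norm_num [QP_zero_neg_one, QP_zero_zero] at h
  linear_combination h

theorem hasTopCoeff_QP_zero_natCast (j : ℕ) :
    HasTopCoeff (QP 0 (0 + j)) (0 + j * 1) (1 * (-1) ^ j) := by
  refine HasTopCoeff.of_recurrence (QP_add_one _) (alphaP_zero ▸ hasTopCoeff_sub_X) (by omega) 0
    (QP_zero_zero ▸ HasTopCoeff.const 1) ?_ j
  rw [zero_sub, QP_zero_neg_one]
  simp

theorem hasTopCoeff_QP_zero_neg_two_sub (j : ℕ) :
    HasTopCoeff (QP 0 (-2 - j)) (0 + j * 1) (-1 * (-1) ^ j) := by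
  refine HasTopCoeff.of_recurrence_neg (QP_add_one _) (alphaP_zero ▸ hasTopCoeff_sub_X)
    (by omega) (-2) (by simpa [QP_zero_neg_two] using HasTopCoeff.const (-1 : A)) ?_ j
  norm_num [QP_zero_neg_one]

theorem hasTopCoeff_QP_neg_one_add (k j : ℕ) :
    HasTopCoeff (QP (-1 - k) (1 + j)) (1 + j * (2 * k + 3)) (-1 * ((-1) ^ k) ^ j) := by
  refine HasTopCoeff.of_recurrence (QP_add_one _) (hasTopCoeff_alphaP_neg k) (by omega) 1
    (QP_one _ ▸ hasTopCoeff_sub_X) ?_ j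
  rw [sub_self]
  have := (hasTopCoeff_QP_zero_neg k).1
  omega

theorem hasTopCoeff_QP_neg_neg (k j : ℕ) :
    HasTopCoeff (QP (-1 - k) (0 - j)) (2 * k + j * (2 * k + 3)) ((-1) ^ k * ((-1) ^ k) ^ j) := by
  refine HasTopCoeff.of_recurrence_neg (QP_add_one _) (hasTopCoeff_alphaP_neg k) (by omega) 0
    (hasTopCoeff_QP_zero_neg k) ?_ j
  rw [zero_add, QP_one]
  have := hasTopCoeff_sub_X.1
  omega

theorem C_neg_one_zpow {z t : ℤ} {N : ℕ} (h : z = N + 2 * t) :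
    (MvPolynomial.C ((-1 : ℂ) ^ z) : A) = (-1) ^ N := by
  rw [h, zpow_add₀ (by norm_num), zpow_mul]
  simp

/-- The `y`-degree and leading coefficient (in `y`) of `Q`, in the ten cases of
Proposition 5 of the paper. -/
theorem Q_degree_leadingCoeff (m n : ℤ) :
    (m ≥ 2 → n ≥ 2 →
      (QP m n).natDegree = (2 * m * n - 2 * m - n).toNat ∧
      (QP m n).leadingCoeff
        = MvPolynomial.C ((-1 : ℂ) ^ ((m - 1) * (n - 1))) * MvPolynomial.X 1 ^ 2) ∧
    (m ≥ 2 → n ≤ 1 →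
      (QP m n).natDegree = (-(2 * m * n) + 2 * m + n).toNat ∧
      (QP m n).leadingCoeff = MvPolynomial.C (-((-1 : ℂ) ^ ((m - 1) * (n - 1))))) ∧
    (m = 1 → n ≥ 3 →
      (QP m n).natDegree = (n - 2).toNat ∧
      (QP m n).leadingCoeff = MvPolynomial.X 1 ^ 2) ∧
    (m = 1 → n = 2 → QP m n = Polynomial.C (MvPolynomial.X 1 ^ 2 - 1)) ∧
    (m = 1 → n ≤ 1 →
      (QP m n).natDegree = (2 - n).toNat ∧
      (QP m n).leadingCoeff = -1) ∧
    (m = 0 → n ≥ 0 →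
      (QP m n).natDegree = n.toNat ∧
      (QP m n).leadingCoeff = MvPolynomial.C ((-1 : ℂ) ^ n)) ∧
    (m = 0 → n = -1 → QP m n = 0) ∧
    (m = 0 → n ≤ -2 →
      (QP m n).natDegree = (-(n + 2)).toNat ∧
      (QP m n).leadingCoeff = MvPolynomial.C ((-1 : ℂ) ^ (n - 1))) ∧
    (m ≤ -1 → n ≥ 1 →
      (QP m n).natDegree = (-(2 * m * n) + 2 * m + n).toNat ∧
      (QP m n).leadingCoeff = MvPolynomial.C (-((-1 : ℂ) ^ ((m - 1) * (n - 1))))) ∧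
    (m ≤ -1 → n ≤ 0 →
      (QP m n).natDegree = (2 * m * n - 2 * m - n - 2).toNat ∧
      (QP m n).leadingCoeff = MvPolynomial.C ((-1 : ℂ) ^ ((m - 1) * (n - 1)))) := by
  refine ⟨?_, ?_, ?_, ?_, ?_, ?_, ?_, ?_, ?_, ?_⟩
  · intro hm hn
    obtain ⟨k, rfl⟩ : ∃ k : ℕ, m = k + 2 := ⟨(m - 2).toNat, by omega⟩
    obtain ⟨j, rfl⟩ : ∃ j : ℕ, n = 2 + j := ⟨(n - 2).toNat, by omega⟩
    refine (hasTopCoeff_QP_add_two_add_two k j).natDegree_eq_and_leadingCoeff_eq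
      (by simp) (by push_cast; ring) ?_
    rw [C_neg_one_zpow (N := (k + 1) * (j + 1)) (t := 0) (by push_cast; ring)]
    ring
  · intro hm hn
    obtain ⟨k, rfl⟩ : ∃ k : ℕ, m = k + 2 := ⟨(m - 2).toNat, by omega⟩
    rcases hn.eq_or_lt with rfl | hn
    · exact (QP_one (k + 2) ▸ hasTopCoeff_sub_X).natDegree_eq_and_leadingCoeff_eq
        (by simp) (by push_cast; ring) (by simp)
    obtain ⟨j, rfl⟩ : ∃ j : ℕ, n = 0 - j := ⟨(-n).toNat, by omega⟩
    refine (hasTopCoeff_QP_add_two_neg k j).natDegree_eq_and_leadingCoeff_eq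
      (by simp) (by push_cast; ring) ?_
    rw [map_neg, C_neg_one_zpow (N := (k + 1) * (j + 1)) (t := -((k + 1) * (j + 1)))
      (by push_cast; ring)]
    ring
  · rintro rfl hn
    obtain ⟨j, rfl⟩ : ∃ j : ℕ, n = 3 + j := ⟨(n - 3).toNat, by omega⟩
    exact (hasTopCoeff_QP_one_add_three j).natDegree_eq_and_leadingCoeff_eq
      (by simp) (by push_cast; ring) (by simp)
  · rintro rfl rfl
    exact QP_one_two
  · rintro rfl hn
    rcases hn.eq_or_lt with rfl | hn
    · exact (QP_one 1 ▸ hasTopCoeff_sub_X).natDegree_eq_and_leadingCoeff_eq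
        (by simp) (by norm_num) rfl
    obtain ⟨j, rfl⟩ : ∃ j : ℕ, n = 0 - j := ⟨(-n).toNat, by omega⟩
    exact (hasTopCoeff_QP_one_neg j).natDegree_eq_and_leadingCoeff_eq
      (by simp) (by push_cast; ring) (by simp)
  · rintro rfl hn
    obtain ⟨j, rfl⟩ : ∃ j : ℕ, n = 0 + j := ⟨n.toNat, by omega⟩
    refine (hasTopCoeff_QP_zero_natCast j).natDegree_eq_and_leadingCoeff_eq
      (by simp) (by push_cast; ring) ?_
    rw [C_neg_one_zpow (N := j) (t := 0) (by ring), one_mul]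
  · rintro rfl rfl
    exact QP_zero_neg_one
  · rintro rfl hn
    obtain ⟨j, rfl⟩ : ∃ j : ℕ, n = -2 - j := ⟨(-2 - n).toNat, by omega⟩
    refine (hasTopCoeff_QP_zero_neg_two_sub j).natDegree_eq_and_leadingCoeff_eq
      (by simp) (by push_cast; ring) ?_
    rw [C_neg_one_zpow (N := j + 1) (t := -(j + 2)) (by push_cast; ring)]
    ring
  · intro hm hn
    obtain ⟨k, rfl⟩ : ∃ k : ℕ, m = -1 - k := ⟨(-1 - m).toNat, by omega⟩
    obtain ⟨j, rfl⟩ : ∃ j : ℕ, n = 1 + j := ⟨(n - 1).toNat, by omega⟩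
    refine (hasTopCoeff_QP_neg_one_add k j).natDegree_eq_and_leadingCoeff_eq
      (by simp) (by push_cast; ring) ?_
    rw [map_neg, C_neg_one_zpow (N := k * j) (t := -((k + 1) * j)) (by push_cast; ring)]
    ring
  · intro hm hn
    obtain ⟨k, rfl⟩ : ∃ k : ℕ, m = -1 - k := ⟨(-1 - m).toNat, by omega⟩
    obtain ⟨j, rfl⟩ : ∃ j : ℕ, n = 0 - j := ⟨(-n).toNat, by omega⟩
    refine (hasTopCoeff_QP_neg_neg k j).natDegree_eq_and_leadingCoeff_eq
      (by simp) (by push_cast; ring) ?_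
    rw [C_neg_one_zpow (N := k * (j + 1)) (t := j + 1) (by push_cast; ring)]
    ring
end
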